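/- arXiv:1503.01472 — 2 statements merged into one kernel-verified Lean document; each statement's English description precedes it below -/
import Mathlib

section
/- For every τ in the upper half-plane ℍ and every z ∈ ℂ with z ∉ ℤτ + ℤ, one has μ_{1,0}(τ,z) = Ψ_{1,1}(τ,z); that is, ∑_{k∈ℤ} u^{2k} q^{k²} (u q^k + 1)/(u q^k − 1) = −i θ₁(τ,2z) η(τ)³ / θ₁(τ,z)². -/
noncomputable section

open Complex

/-- `q = e^{2πiτ}` (also used for `u = e^{2πiz}`). -/
def qq (τ : ℂ) : ℂ := exp (2 * ↑Real.pi * I * τ)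

/-- The Dedekind eta function `η(τ) = q^{1/24} ∏_{n≥1} (1 − qⁿ)`. -/
def dedekindEta (τ : ℂ) : ℂ := exp (2 * ↑Real.pi * I * τ / 24) * ∏' n : ℕ, (1 - qq τ ^ (n + 1))

/-- The Jacobi theta function
`θ₁(τ,z) = −i q^{1/8} u^{1/2} ∏_{n≥1} (1 − u⁻¹qⁿ⁻¹)(1 − uqⁿ)(1 − qⁿ)`. -/
def theta1 (τ z : ℂ) : ℂ :=
  -I * exp (2 * ↑Real.pi * I * τ / 8) * exp (↑Real.pi * I * z) *
    ∏' n : ℕ, ((1 - (qq z)⁻¹ * qq τ ^ n) * (1 - qq z * qq τ ^ (n + 1)) * (1 - qq τ ^ (n + 1)))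

/-- `Ψ_{1,1}(τ,z) = −i θ₁(τ,2z) η(τ)³ / θ₁(τ,z)²`. -/
def Psi11 (τ z : ℂ) : ℂ := -I * theta1 τ (2 * z) * dedekindEta τ ^ 3 / theta1 τ z ^ 2

/-- `μ_{m,0}(τ,z) = ∑_{k∈ℤ} u^{2km} q^{mk²} (uq^k + 1)/(uq^k − 1)`. -/
def mu (m : ℕ) (τ z : ℂ) : ℂ :=
  ∑' k : ℤ, qq z ^ (2 * k * (m : ℤ)) * qq τ ^ ((m : ℤ) * k ^ 2) *
    ((qq z * qq τ ^ k + 1) / (qq z * qq τ ^ k - 1))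

open Filter Topology

/-- The shifted `q`-Pochhammer symbol `∏_{1 ≤ i ≤ m} (1 - c qⁱ)`. -/
def qPoch (q c : ℂ) (m : ℕ) : ℂ := ∏ i ∈ Finset.range m, (1 - c * q ^ (i + 1))

/-- The infinite `q`-Pochhammer symbol `∏_{i ≥ 1} (1 - c qⁱ)`. -/
def qPochInf (q c : ℂ) : ℂ := ∏' i : ℕ, (1 - c * q ^ (i + 1))

/-- `1 / ((q; q)_m (aq; q)_m)`, extended by zero to negative `m`. -/
def qPochInv (q a : ℂ) (m : ℤ) : ℂ :=
  if m < 0 then 0 else (qPoch q 1 m.toNat * qPoch q a m.toNat)⁻¹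

theorem qPoch_succ (q c : ℂ) (m : ℕ) :
    qPoch q c (m + 1) = qPoch q c m * (1 - c * q ^ (m + 1)) :=
  Finset.prod_range_succ _ _

theorem qPochInv_of_neg (q a : ℂ) {m : ℤ} (hm : m < 0) : qPochInv q a m = 0 := if_pos hm

theorem qPochInv_natCast (q a : ℂ) (m : ℕ) :
    qPochInv q a m = (qPoch q 1 m * qPoch q a m)⁻¹ := by
  simp [qPochInv]

theorem qPochInv_sub_one {q a : ℂ} (h1 : ∀ k : ℕ, 1 - q ^ (k + 1) ≠ 0)
    (ha : ∀ k : ℕ, 1 - a * q ^ (k + 1) ≠ 0) (m : ℤ) :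
    qPochInv q a (m - 1) = (1 - q ^ m) * (1 - a * q ^ m) * qPochInv q a m := by
  rcases lt_trichotomy m 0 with hm | rfl | hm
  · rw [qPochInv_of_neg _ _ hm, qPochInv_of_neg _ _ (by omega), mul_zero]
  · rw [qPochInv_of_neg _ _ (by omega)]
    simp
  · obtain ⟨k, rfl⟩ : ∃ k : ℕ, m = (k + 1 : ℕ) := ⟨(m - 1).toNat, by omega⟩
    rw [show ((k + 1 : ℕ) : ℤ) - 1 = (k : ℕ) by push_cast; ring, qPochInv_natCast,
      qPochInv_natCast, qPoch_succ, qPoch_succ, zpow_natCast]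
    have h1k := h1 k
    have hak := ha k
    rw [one_mul, mul_mul_mul_comm, mul_inv_rev (_ * _), mul_inv_cancel_left₀ (mul_ne_zero h1k hak)]

theorem qPochInv_mul_eq_zero (q a b : ℂ) (M N : ℕ) {n : ℤ}
    (hn : n ∉ Finset.Icc (-(N : ℤ)) M) :
    qPochInv q a (N + n) * qPochInv q b (M - n) = 0 := by
  rw [Finset.mem_Icc, not_and_or] at hn
  rcases hn with hn | hn
  · rw [qPochInv_of_neg _ _ (by omega), zero_mul]
  · rw [qPochInv_of_neg q b (by omega), mul_zero]

theorem summable_norm_mul_pow_succ {q : ℂ} (hq : ‖q‖ < 1) (c : ℂ) :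
    Summable fun i : ℕ ↦ ‖-(c * q ^ (i + 1))‖ := by
  have h := (summable_geometric_of_lt_one (norm_nonneg q) hq).mul_left (‖c‖ * ‖q‖)
  refine h.congr fun i ↦ ?_
  rw [norm_neg, norm_mul, norm_pow]
  ring

theorem multipliable_one_sub_mul_pow_succ {q : ℂ} (hq : ‖q‖ < 1) (c : ℂ) :
    Multipliable fun i : ℕ ↦ 1 - c * q ^ (i + 1) := by
  simpa only [sub_eq_add_neg] using
    multipliable_one_add_of_summable (summable_norm_mul_pow_succ hq c)

theorem tendsto_qPoch {q : ℂ} (hq : ‖q‖ < 1) (c : ℂ) :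
    Tendsto (qPoch q c) atTop (𝓝 (qPochInf q c)) :=
  (multipliable_one_sub_mul_pow_succ hq c).tendsto_prod_tprod_nat

theorem qPochInf_ne_zero {q c : ℂ} (hq : ‖q‖ < 1) (hc : ∀ k : ℕ, 1 - c * q ^ (k + 1) ≠ 0) :
    qPochInf q c ≠ 0 := by
  simp only [qPochInf, sub_eq_add_neg] at hc ⊢
  exact tprod_one_add_ne_zero_of_summable hc (summable_norm_mul_pow_succ hq c)

theorem tendsto_qPochInv_natCast {q a : ℂ} (hq : ‖q‖ < 1) (h1 : qPochInf q 1 ≠ 0)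
    (ha : qPochInf q a ≠ 0) :
    Tendsto (fun m : ℕ ↦ qPochInv q a m) atTop (𝓝 (qPochInf q 1 * qPochInf q a)⁻¹) := by
  simp only [qPochInv_natCast]
  exact ((tendsto_qPoch hq 1).mul (tendsto_qPoch hq a)).inv₀ (mul_ne_zero h1 ha)

theorem tendsto_qPochInv {q a : ℂ} (hq : ‖q‖ < 1) (h1 : qPochInf q 1 ≠ 0)
    (ha : qPochInf q a ≠ 0) :
    Tendsto (qPochInv q a) atTop (𝓝 (qPochInf q 1 * qPochInf q a)⁻¹) := by
  refine ((tendsto_qPochInv_natCast hq h1 ha).comp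
    (tendsto_atTop_mono Int.self_le_toNat tendsto_id |> tendsto_natCast_atTop_iff.mp)).congr' ?_
  filter_upwards [eventually_ge_atTop 0] with m hm
  simp [Int.toNat_of_nonneg hm]

theorem exists_norm_le_of_tendsto {f : ℕ → ℂ} {l : ℂ} (hf : Tendsto f atTop (𝓝 l)) :
    ∃ C, 0 ≤ C ∧ ∀ n, ‖f n‖ ≤ C := by
  obtain ⟨C, hC⟩ := (Metric.isBounded_range_of_tendsto f hf).exists_norm_le
  exact ⟨C, (norm_nonneg _).trans (hC _ ⟨0, rfl⟩), fun n ↦ hC _ ⟨n, rfl⟩⟩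

theorem exists_norm_qPochInv_le {q a : ℂ} (hq : ‖q‖ < 1) (h1 : qPochInf q 1 ≠ 0)
    (ha : qPochInf q a ≠ 0) : ∃ C, 0 ≤ C ∧ ∀ m, ‖qPochInv q a m‖ ≤ C := by
  obtain ⟨C, h0, hC⟩ := exists_norm_le_of_tendsto (tendsto_qPochInv_natCast hq h1 ha)
  refine ⟨C, h0, fun m ↦ ?_⟩
  rcases lt_or_ge m 0 with hm | hm
  · simpa [qPochInv_of_neg q a hm] using h0
  · lift m to ℕ using hm
    exact hC m

theorem exists_norm_add_div_sub_le {q x : ℂ} (hq0 : q ≠ 0) (hq : ‖q‖ < 1) (hx : x ≠ 0) :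
    ∃ C, 0 ≤ C ∧ ∀ n : ℤ, ‖(x * q ^ n + 1) / (x * q ^ n - 1)‖ ≤ C := by
  have hpow := tendsto_pow_atTop_nhds_zero_of_norm_lt_one hq
  have hpos : Tendsto (fun n : ℕ ↦ (x * q ^ n + 1) / (x * q ^ n - 1)) atTop
      (𝓝 ((x * 0 + 1) / (x * 0 - 1))) :=
    ((hpow.const_mul x).add_const 1).div ((hpow.const_mul x).sub_const 1) (by simp)
  have hneg : Tendsto (fun n : ℕ ↦ (x + q ^ n) / (x - q ^ n)) atTop
      (𝓝 ((x + 0) / (x - 0))) :=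
    (hpow.const_add x).div (hpow.const_sub x) (by simpa using hx)
  obtain ⟨C, h0, hC⟩ := exists_norm_le_of_tendsto hpos
  obtain ⟨D, _, hD⟩ := exists_norm_le_of_tendsto hneg
  refine ⟨max C D, le_max_of_le_left h0, fun n ↦ ?_⟩
  obtain ⟨k, rfl | rfl⟩ := n.eq_nat_or_neg
  · simpa only [zpow_natCast] using (hC k).trans (le_max_left C D)
  · have hk : q ^ k ≠ 0 := pow_ne_zero k hq0
    have : (x * q ^ (-(k : ℤ)) + 1) / (x * q ^ (-(k : ℤ)) - 1) = (x + q ^ k) / (x - q ^ k) := by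
      rw [zpow_neg, zpow_natCast, ← mul_div_mul_right _ _ hk]
      congr 1 <;> field_simp
    rw [this]
    exact (hD k).trans (le_max_right C D)

/-- The summand `u^{2n} q^{n²} (u qⁿ + 1) / (u qⁿ - 1)` of `μ_{1,0}`, with `u = x`. -/
def muTerm (q x : ℂ) (n : ℤ) : ℂ :=
  (x ^ 2) ^ n * q ^ n ^ 2 * ((x * q ^ n + 1) / (x * q ^ n - 1))

/-- The summand of the bilateral truncation of `μ_{1,0}`, a terminating very-well-poised sum. -/
def truncTerm (q x : ℂ) (N : ℕ) (n : ℤ) : ℂ :=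
  muTerm q x n * (qPochInv q (x ^ 2) (N + n) * qPochInv q (x ^ 2)⁻¹ (N - n))

/-- The rational factor, in the variable `y = qⁿ` and with `Q = q^{N+1}`, of the WZ certificate
for the sum of `truncTerm`. -/
def wzFactor (q x Q y : ℂ) : ℂ :=
  -Q * (Q / (q - Q ^ 2)
    - (((x + 1 / x) * (1 + Q ^ 2) - 2 * Q) * x + Q ^ 2 * (1 + x ^ 2) * (1 - q) / (q - Q ^ 2))
      / (x ^ 2 * (1 - Q ^ 2)) / y
    + q * Q / (x ^ 2 * (q - Q ^ 2)) / y ^ 2)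

/-- The WZ mate of `truncTerm`. -/
def wzMate (q x : ℂ) (N : ℕ) (n : ℤ) : ℂ :=
  (x ^ 2) ^ n * q ^ n ^ 2 * wzFactor q x (q ^ (N + 1)) (q ^ n) *
    (qPochInv q (x ^ 2) (N + n) * qPochInv q (x ^ 2)⁻¹ ((N + 1 : ℕ) - n))

theorem wzFactor_identity {q x y Q : ℂ} (K E r₁ r₂ : ℂ) (hq : q ≠ 0) (hx : x ≠ 0) (hy : y ≠ 0)
    (hw : x * y - 1 ≠ 0) (h1 : 1 - Q ^ 2 ≠ 0) (h2 : q - Q ^ 2 ≠ 0) :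
    K * ((1 - x * Q) * (1 - x⁻¹ * Q)) ^ 2 * (E * ((x * y + 1) / (x * y - 1)) * (r₁ * r₂))
      - K * (E * ((x * y + 1) / (x * y - 1)) *
        (((1 - Q * y) * (1 - x ^ 2 * (Q * y)) * r₁) *
          ((1 - Q / y) * (1 - (x ^ 2)⁻¹ * (Q / y)) * r₂)))
    = K * ((E * (x ^ 2 * q * y ^ 2)) * wzFactor q x Q (q * y) *
        (r₁ * ((1 - Q / y) * (1 - (x ^ 2)⁻¹ * (Q / y)) * r₂)))
      - K * (E * wzFactor q x Q y * (((1 - Q * y) * (1 - x ^ 2 * (Q * y)) * r₁) * r₂)) := by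
  rw [wzFactor, wzFactor]
  field_simp
  ring

theorem one_sub_pow_succ_ne_zero {q : ℂ} (hq : ‖q‖ < 1) (k : ℕ) : 1 - q ^ (k + 1) ≠ 0 := by
  intro h
  have h1 : ‖q ^ (k + 1)‖ = 1 := by rw [← sub_eq_zero.mp h, norm_one]
  rw [norm_pow] at h1
  exact (pow_lt_one₀ (norm_nonneg q) hq k.succ_ne_zero).ne h1

theorem one_sub_mul_pow_succ_ne_zero {q c : ℂ} (hc : ∀ n : ℤ, 1 - c * q ^ n ≠ 0) (k : ℕ) :
    1 - c * q ^ (k + 1) ≠ 0 := by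
  exact_mod_cast hc (k + 1 : ℕ)

theorem one_sub_inv_mul_zpow_ne_zero {q c : ℂ} (hq0 : q ≠ 0) (hc0 : c ≠ 0)
    (hc : ∀ n : ℤ, 1 - c * q ^ n ≠ 0) (n : ℤ) : 1 - c⁻¹ * q ^ n ≠ 0 := by
  intro h
  apply hc (-n)
  have hqn : q ^ n ≠ 0 := zpow_ne_zero n hq0
  have : q ^ n = c := by
    field_simp at h
    linear_combination -h
  rw [zpow_neg, this, mul_inv_cancel₀ hc0, sub_self]

theorem truncTerm_eq_zero (q x : ℂ) (N : ℕ) {n : ℤ} (hn : n ∉ Finset.Icc (-(N : ℤ)) N) :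
    truncTerm q x N n = 0 := by
  rw [truncTerm, qPochInv_mul_eq_zero _ _ _ _ _ hn, mul_zero]

theorem summable_truncTerm (q x : ℂ) (N : ℕ) : Summable (truncTerm q x N) :=
  summable_of_ne_finset_zero fun _ ↦ truncTerm_eq_zero q x N

theorem summable_wzMate (q x : ℂ) (N : ℕ) : Summable (wzMate q x N) :=
  summable_of_ne_finset_zero (s := Finset.Icc (-(N : ℤ)) (N + 1 : ℕ)) fun n hn ↦ by
    rw [wzMate, qPochInv_mul_eq_zero _ _ _ _ _ hn, mul_zero]

theorem truncTerm_succ_sub {q x : ℂ} (hq0 : q ≠ 0) (hq : ‖q‖ < 1) (hx : x ≠ 0)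
    (hxq : ∀ n : ℤ, x * q ^ n - 1 ≠ 0) (hx2 : ∀ n : ℤ, 1 - x ^ 2 * q ^ n ≠ 0)
    (K : ℂ) (N : ℕ) (n : ℤ) :
    K * ((1 - x * q ^ (N + 1)) * (1 - x⁻¹ * q ^ (N + 1))) ^ 2 * truncTerm q x (N + 1) n
      - K * truncTerm q x N n
    = K * wzMate q x N (n + 1) - K * wzMate q x N n := by
  have h1 := one_sub_pow_succ_ne_zero hq
  have ha := one_sub_mul_pow_succ_ne_zero hx2
  have hb := one_sub_mul_pow_succ_ne_zero
    (one_sub_inv_mul_zpow_ne_zero hq0 (pow_ne_zero 2 hx) hx2)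
  have hQ1 : 1 - (q ^ (N + 1)) ^ 2 ≠ 0 := by
    have := h1 (2 * N + 1)
    rwa [← pow_mul, show (N + 1) * 2 = 2 * N + 1 + 1 by ring]
  have hQ2 : q - (q ^ (N + 1)) ^ 2 ≠ 0 := by
    have := mul_ne_zero hq0 (h1 (2 * N))
    convert this using 1
    ring
  have hra := qPochInv_sub_one h1 ha ((N + 1 : ℕ) + n)
  have hrb := qPochInv_sub_one h1 hb ((N + 1 : ℕ) - n)
  rw [show ((N + 1 : ℕ) : ℤ) + n - 1 = N + n by push_cast; ring, zpow_add₀ hq0,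
    zpow_natCast] at hra
  rw [show ((N + 1 : ℕ) : ℤ) - n - 1 = N - n by push_cast; ring, zpow_sub₀ hq0,
    zpow_natCast] at hrb
  have key := wzFactor_identity K ((x ^ 2) ^ n * q ^ n ^ 2)
    (qPochInv q (x ^ 2) ((N + 1 : ℕ) + n)) (qPochInv q (x ^ 2)⁻¹ ((N + 1 : ℕ) - n))
    hq0 hx (zpow_ne_zero n hq0) (hxq n) hQ1 hQ2
  rw [← hra, ← hrb] at key
  rw [truncTerm, truncTerm, muTerm, wzMate, wzMate, key,
    show (N : ℤ) + (n + 1) = (N + 1 : ℕ) + n by push_cast; ring,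
    show ((N + 1 : ℕ) : ℤ) - (n + 1) = N - n by push_cast; ring,
    show (n + 1) ^ 2 = n ^ 2 + (1 + n * 2) by ring, zpow_add₀ hq0 (n ^ 2), zpow_add₀ hq0 1,
    zpow_mul, zpow_add₀ hq0 n, zpow_add₀ (pow_ne_zero 2 hx), zpow_one, zpow_one, zpow_ofNat,
    mul_comm (q ^ n) q]
  ring

/-- The bilateral truncated sum, a special case of the terminating `₆φ₅` summation. -/
theorem tsum_truncTerm {q x : ℂ} (hq0 : q ≠ 0) (hq : ‖q‖ < 1) (hx : x ≠ 0)
    (hxq : ∀ n : ℤ, x * q ^ n - 1 ≠ 0) (hx2 : ∀ n : ℤ, 1 - x ^ 2 * q ^ n ≠ 0) (N : ℕ) :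
    (qPoch q x N * qPoch q x⁻¹ N) ^ 2 * ∑' n, truncTerm q x N n = (x + 1) / (x - 1) := by
  induction N with
  | zero =>
    rw [tsum_eq_single 0 fun n hn ↦ truncTerm_eq_zero q x 0 (by simpa using hn)]
    simp [truncTerm, muTerm, qPochInv, qPoch]
  | succ N ih =>
    rw [← ih, ← sub_eq_zero, qPoch_succ, qPoch_succ, ← tsum_mul_left, ← tsum_mul_left,
      ← ((summable_truncTerm q x (N + 1)).mul_left _).tsum_sub
        ((summable_truncTerm q x N).mul_left _)]
    have hG := (summable_wzMate q x N).mul_left ((qPoch q x N * qPoch q x⁻¹ N) ^ 2)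
    have hG' : Summable fun n ↦
        (qPoch q x N * qPoch q x⁻¹ N) ^ 2 * wzMate q x N (Equiv.addRight (1 : ℤ) n) :=
      (Equiv.addRight (1 : ℤ)).summable_iff.mpr hG
    have hshift := (Equiv.addRight (1 : ℤ)).tsum_eq
      fun n ↦ (qPoch q x N * qPoch q x⁻¹ N) ^ 2 * wzMate q x N n
    rw [← sub_eq_zero, ← hG'.tsum_sub hG] at hshift
    rw [← hshift]
    refine tsum_congr fun n ↦ ?_
    have h := truncTerm_succ_sub hq0 hq hx hxq hx2 ((qPoch q x N * qPoch q x⁻¹ N) ^ 2) N n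
    simp only [Equiv.coe_addRight]
    rw [← h]
    ring

theorem tsum_muTerm_eq {q x : ℂ} (hq0 : q ≠ 0) (hq : ‖q‖ < 1) (hx : x ≠ 0)
    (hxq : ∀ n : ℤ, x * q ^ n - 1 ≠ 0) (hx2 : ∀ n : ℤ, 1 - x ^ 2 * q ^ n ≠ 0)
    (hS : Summable fun n : ℤ ↦ (x ^ 2) ^ n * q ^ n ^ 2) :
    (qPochInf q x * qPochInf q x⁻¹) ^ 2 * ∑' n, muTerm q x n =
      (x + 1) / (x - 1) *
        (qPochInf q 1 ^ 2 * qPochInf q (x ^ 2) * qPochInf q (x ^ 2)⁻¹) := by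
  have h1 : qPochInf q 1 ≠ 0 :=
    qPochInf_ne_zero hq fun k ↦ by simpa using one_sub_pow_succ_ne_zero hq k
  have ha : qPochInf q (x ^ 2) ≠ 0 := qPochInf_ne_zero hq (one_sub_mul_pow_succ_ne_zero hx2)
  have hb : qPochInf q (x ^ 2)⁻¹ ≠ 0 := qPochInf_ne_zero hq
    (one_sub_mul_pow_succ_ne_zero (one_sub_inv_mul_zpow_ne_zero hq0 (pow_ne_zero 2 hx) hx2))
  obtain ⟨A, hA0, hA⟩ := exists_norm_qPochInv_le hq h1 ha
  obtain ⟨B, hB0, hB⟩ := exists_norm_qPochInv_le hq h1 hb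
  obtain ⟨C, hC0, hC⟩ := exists_norm_add_div_sub_le hq0 hq hx
  have hlim : Tendsto (fun N : ℕ ↦ ∑' n, truncTerm q x N n) atTop
      (𝓝 (∑' n, muTerm q x n * ((qPochInf q 1 * qPochInf q (x ^ 2))⁻¹ *
        (qPochInf q 1 * qPochInf q (x ^ 2)⁻¹)⁻¹))) := by
    refine tendsto_tsum_of_dominated_convergence
      (bound := fun n : ℤ ↦ ‖(x ^ 2) ^ n * q ^ n ^ 2‖ * C * (A * B))
      ((hS.norm.mul_right C).mul_right (A * B)) (fun n ↦ ?_) (Eventually.of_forall fun N n ↦ ?_)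
    · have hN : Tendsto (fun N : ℕ ↦ (N : ℤ)) atTop atTop := tendsto_natCast_atTop_atTop
      exact (((tendsto_qPochInv hq h1 ha).comp (tendsto_atTop_add_const_right _ n hN)).mul
        ((tendsto_qPochInv hq h1 hb).comp
          (tendsto_atTop_add_const_right _ (-n) hN))).const_mul _
    · rw [truncTerm, muTerm, norm_mul, norm_mul, norm_mul (qPochInv _ _ _)]
      gcongr
      exacts [hC n, hA _, hB _]
  have hK := ((tendsto_qPoch hq x).mul (tendsto_qPoch hq x⁻¹)).pow 2
  have hfin := tendsto_nhds_unique (hK.mul hlim)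
    (tendsto_const_nhds.congr fun N ↦ (tsum_truncTerm hq0 hq hx hxq hx2 N).symm)
  rw [tsum_mul_right] at hfin
  rw [← hfin]
  generalize qPochInf q (x ^ 2)⁻¹ = b at *
  field_simp

/-- If `x²` is a power of `q`, the summands cancel in pairs. -/
theorem tsum_muTerm_eq_zero {q x : ℂ} (hq0 : q ≠ 0) (hx : x ≠ 0) {j : ℤ}
    (hj : x ^ 2 * q ^ j = 1) : ∑' n, muTerm q x n = 0 := by
  have hneg : ∀ n, muTerm q x (j - n) = -muTerm q x n := fun n ↦ by
    have hqn : q ^ n ≠ 0 := zpow_ne_zero n hq0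
    have hx2 : x ^ 2 = q ^ (-j) := by
      rw [zpow_neg, eq_inv_of_mul_eq_one_left hj]
    have h1 : (x ^ 2) ^ (j - n) * q ^ (j - n) ^ 2 = (x ^ 2) ^ n * q ^ n ^ 2 := by
      rw [hx2, ← zpow_mul, ← zpow_mul, ← zpow_add₀ hq0, ← zpow_add₀ hq0]
      congr 1
      ring
    have h2 : x * q ^ (j - n) = (x * q ^ n)⁻¹ := by
      refine eq_inv_of_mul_eq_one_left ?_
      rw [← hj, zpow_sub₀ hq0]
      field_simp
    have h3 : x * q ^ n ≠ 0 := mul_ne_zero hx hqn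
    rw [muTerm, muTerm, h1, h2, ← mul_neg]
    congr 1
    rw [← mul_div_mul_right _ _ h3, ← div_neg]
    congr 1 <;> field_simp <;> ring
  have h := (Equiv.subLeft j).tsum_eq (muTerm q x)
  simp only [Equiv.subLeft_apply, hneg, tsum_neg] at h
  linear_combination -h / 2

theorem qq_zpow (w : ℂ) (n : ℤ) : qq w ^ n = exp (2 * Real.pi * I * (n * w)) := by
  rw [qq, ← exp_int_mul]
  ring_nf

theorem norm_qq_lt_one {τ : ℂ} (hτ : 0 < τ.im) : ‖qq τ‖ < 1 :=
  UpperHalfPlane.norm_exp_two_pi_I_lt_one ⟨τ, hτ⟩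

theorem qq_mul_zpow_ne_one {τ z : ℂ} (hz : ∀ a b : ℤ, z ≠ (a : ℂ) * τ + (b : ℂ)) (n : ℤ) :
    qq z * qq τ ^ n - 1 ≠ 0 := by
  rw [qq_zpow, qq, ← exp_add, sub_ne_zero, Ne, exp_eq_one_iff]
  rintro ⟨b, hb⟩
  apply hz (-n) b
  have hpi : 2 * (Real.pi : ℂ) * I ≠ 0 := two_pi_I_ne_zero
  apply mul_left_cancel₀ hpi
  push_cast
  linear_combination hb

theorem qq_two_mul (z : ℂ) : qq (2 * z) = qq z ^ 2 := by
  rw [qq, qq, ← exp_nat_mul]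
  push_cast
  ring_nf

theorem summable_qq_sq_zpow {τ : ℂ} (hτ : 0 < τ.im) (z : ℂ) :
    Summable fun n : ℤ ↦ (qq z ^ 2) ^ n * qq τ ^ n ^ 2 := by
  have h := (summable_jacobiTheta₂_term_iff (2 * z) (2 * τ)).mpr (by simpa using hτ)
  refine h.congr fun n ↦ ?_
  rw [← qq_two_mul, qq_zpow, qq_zpow, ← exp_add, jacobiTheta₂_term]
  push_cast
  ring_nf

theorem theta1_eq {τ : ℂ} (hτ : 0 < τ.im) (z : ℂ) :
    theta1 τ z = -I * exp (2 * Real.pi * I * τ / 8) * exp (Real.pi * I * z) *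
      ((1 - (qq z)⁻¹) * qPochInf (qq τ) (qq z)⁻¹ * qPochInf (qq τ) (qq z) *
        qPochInf (qq τ) 1) := by
  have hq := norm_qq_lt_one hτ
  have h0 : Multipliable fun n : ℕ ↦ 1 - (qq z)⁻¹ * qq τ ^ n := by
    have := summable_geometric_of_lt_one (norm_nonneg _) hq
    simp only [sub_eq_add_neg]
    refine multipliable_one_add_of_summable ?_
    simpa [norm_mul] using this.mul_left ‖(qq z)⁻¹‖
  have hu := multipliable_one_sub_mul_pow_succ hq (qq z)
  have h1 := multipliable_one_sub_mul_pow_succ hq 1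
  simp only [one_mul] at h1
  have hshift : ∏' n : ℕ, (1 - (qq z)⁻¹ * qq τ ^ n) =
      (1 - (qq z)⁻¹) * qPochInf (qq τ) (qq z)⁻¹ := by
    rw [tprod_eq_zero_mul' (f := fun n ↦ 1 - (qq z)⁻¹ * qq τ ^ n)
      (multipliable_one_sub_mul_pow_succ hq (qq z)⁻¹), pow_zero, mul_one]
    rfl
  have h1' : qPochInf (qq τ) 1 = ∏' n : ℕ, (1 - qq τ ^ (n + 1)) := by
    simp only [qPochInf, one_mul]
  rw [theta1, (h0.mul hu).tprod_mul h1, h0.tprod_mul hu, hshift, h1', ← qPochInf]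

theorem Psi11_eq {τ : ℂ} (hτ : 0 < τ.im) (z : ℂ) (h1 : qPochInf (qq τ) 1 ≠ 0) :
    Psi11 τ z =
      (1 - (qq z ^ 2)⁻¹) * qPochInf (qq τ) (qq z ^ 2)⁻¹ * qPochInf (qq τ) (qq z ^ 2) *
          qPochInf (qq τ) 1 ^ 2 /
        ((1 - (qq z)⁻¹) * qPochInf (qq τ) (qq z)⁻¹ * qPochInf (qq τ) (qq z)) ^ 2 := by
  have heta : dedekindEta τ ^ 3 = exp (2 * Real.pi * I * τ / 8) * qPochInf (qq τ) 1 ^ 3 := by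
    rw [dedekindEta, mul_pow, ← exp_nat_mul]
    simp only [qPochInf, one_mul]
    congr 2
    push_cast
    ring
  have hz : exp (Real.pi * I * (2 * z)) = exp (Real.pi * I * z) ^ 2 := by
    rw [← exp_nat_mul]
    push_cast
    ring_nf
  have he := exp_ne_zero (2 * Real.pi * I * τ / 8)
  have he' := exp_ne_zero (Real.pi * I * z)
  rw [Psi11, theta1_eq hτ, theta1_eq hτ, heta, hz, qq_two_mul]
  generalize exp (2 * Real.pi * I * τ / 8) = s at *
  generalize exp (Real.pi * I * z) = t at *
  generalize (1 - (qq z)⁻¹) * qPochInf (qq τ) (qq z)⁻¹ * qPochInf (qq τ) (qq z) = d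
  generalize (1 - (qq z ^ 2)⁻¹) * qPochInf (qq τ) (qq z ^ 2)⁻¹ * qPochInf (qq τ) (qq z ^ 2) = e
  generalize qPochInf (qq τ) 1 = p at *
  have hc : -I * (-I * s * t ^ 2 * (e * p)) * (s * p ^ 3) =
      -(s ^ 2 * t ^ 2 * p ^ 2) * (e * p ^ 2) := by
    linear_combination s ^ 2 * t ^ 2 * e * p ^ 4 * I_sq
  have hd : (-I * s * t * (d * p)) ^ 2 = -(s ^ 2 * t ^ 2 * p ^ 2) * d ^ 2 := by
    linear_combination s ^ 2 * t ^ 2 * d ^ 2 * p ^ 2 * I_sq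
  rw [hc, hd, mul_div_mul_left]
  simp [he, he', h1]

/-- The numerator of `Ψ_{1,1}` vanishes if `c = u²` is a power of `q`. -/
theorem qPochInf_mul_eq_zero {q c : ℂ} (hq0 : q ≠ 0) {j : ℤ} (hj : c * q ^ j = 1) :
    (1 - c⁻¹) * qPochInf q c⁻¹ * qPochInf q c = 0 := by
  rcases lt_trichotomy j 0 with h | rfl | h
  · obtain ⟨k, rfl⟩ : ∃ k : ℕ, j = -(k + 1 : ℕ) := ⟨(-j - 1).toNat, by omega⟩
    have : qPochInf q c⁻¹ = 0 := tprod_of_exists_eq_zero ⟨k, by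
      rw [inv_eq_of_mul_eq_one_right hj, ← zpow_natCast, ← zpow_add₀ hq0]
      simp⟩
    simp [this]
  · simp_all
  · obtain ⟨k, rfl⟩ : ∃ k : ℕ, j = (k + 1 : ℕ) := ⟨(j - 1).toNat, by omega⟩
    have : qPochInf q c = 0 := tprod_of_exists_eq_zero ⟨k, by
      rw [← zpow_natCast, hj, sub_self]⟩
    simp [this]

theorem mu_one_eq (τ z : ℂ) : mu 1 τ z = ∑' n, muTerm (qq τ) (qq z) n := by
  refine tsum_congr fun n ↦ ?_
  rw [muTerm, Nat.cast_one, mul_one, one_mul, zpow_mul, zpow_ofNat]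

/-- For `τ` in the upper half-plane and `z ∉ ℤτ + ℤ`,
`μ_{1,0}(τ,z) = Ψ_{1,1}(τ,z)`. -/
theorem stmt_4 (τ : ℂ) (hτ : 0 < τ.im) (z : ℂ)
    (hz : ∀ a b : ℤ, z ≠ (a : ℂ) * τ + (b : ℂ)) :
    mu 1 τ z = Psi11 τ z := by
  have hq0 : qq τ ≠ 0 := exp_ne_zero _
  have hx : qq z ≠ 0 := exp_ne_zero _
  have hq := norm_qq_lt_one hτ
  have hxq := qq_mul_zpow_ne_one hz
  have h1 : qPochInf (qq τ) 1 ≠ 0 :=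
    qPochInf_ne_zero hq fun k ↦ by simpa using one_sub_pow_succ_ne_zero hq k
  rw [mu_one_eq, Psi11_eq hτ z h1]
  by_cases hx2 : ∀ n : ℤ, 1 - qq z ^ 2 * qq τ ^ n ≠ 0
  · have hxq' : ∀ n : ℤ, 1 - qq z * qq τ ^ n ≠ 0 := fun n h ↦
      hxq n (by linear_combination -h)
    have ha : qPochInf (qq τ) (qq z) ≠ 0 :=
      qPochInf_ne_zero hq (one_sub_mul_pow_succ_ne_zero hxq')
    have hb : qPochInf (qq τ) (qq z)⁻¹ ≠ 0 := qPochInf_ne_zero hq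
      (one_sub_mul_pow_succ_ne_zero (one_sub_inv_mul_zpow_ne_zero hq0 hx hxq'))
    have hz1 : qq z - 1 ≠ 0 := by simpa using hxq 0
    have hz2 : 1 - (qq z)⁻¹ ≠ 0 := by
      simpa using one_sub_inv_mul_zpow_ne_zero hq0 hx hxq' 0
    have h := tsum_muTerm_eq hq0 hq hx hxq hx2 (summable_qq_sq_zpow hτ z)
    rw [eq_div_iff (pow_ne_zero 2 (mul_ne_zero (mul_ne_zero hz2 hb) ha))]
    have hfac : 1 - (qq z ^ 2)⁻¹ = (1 - (qq z)⁻¹) ^ 2 * ((qq z + 1) / (qq z - 1)) := by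
      field_simp
      ring
    rw [hfac]
    linear_combination (1 - (qq z)⁻¹) ^ 2 * h
  · push Not at hx2
    obtain ⟨j, hj⟩ := hx2
    have hj' := (sub_eq_zero.mp hj).symm
    rw [tsum_muTerm_eq_zero hq0 hx hj', qPochInf_mul_eq_zero hq0 hj', zero_mul, zero_div]
end
end

section
/- The function f_{23,b}(τ) := η(τ)² η(23τ)² is a cusp form of weight 2 for Γ₀(23): it is holomorphic on ℍ, satisfies f_{23,b}((aτ+b)/(cτ+d)) = (cτ+d)² f_{23,b}(τ) for every (a b; c d) ∈ Γ₀(23), and (cτ+d)^{−2} f_{23,b}(γτ) → 0 as ℑτ → ∞ for every γ ∈ SL₂(ℤ). -/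
noncomputable section

open Complex

/-- `f_{23,b}(τ) = η(τ)² η(23τ)²`. -/
def f23b (τ : ℂ) : ℂ := dedekindEta τ ^ 2 * dedekindEta (23 * τ) ^ 2

open UpperHalfPlane hiding I
open ModularForm hiding eta
open MatrixGroups

/-- The exponent `F` of the multiplier `exp (2πi F / 12)` of `η²`, modulo `12`. -/
def etaSqExponent (a b c d : ℤ) : ℤ :=
  (1 - c ^ 2) * (b * d + 3 * (c - 1) * d + c + 3) + c * (a + d - 3)

/-- The multiplier `exp (2πi n / 12)`. -/
def twelfthRoot (n : ℤ) : ℂ := exp (2 * Real.pi * I * (n / 12))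

lemma twelfthRoot_add (m n : ℤ) : twelfthRoot (m + n) = twelfthRoot m * twelfthRoot n := by
  rw [twelfthRoot, twelfthRoot, twelfthRoot, ← exp_add]
  push_cast
  ring_nf

lemma twelfthRoot_eq_one {n : ℤ} (h : 12 ∣ n) : twelfthRoot n = 1 := by
  obtain ⟨k, rfl⟩ := h
  rw [twelfthRoot, exp_eq_one_iff]
  exact ⟨k, by push_cast; ring⟩

lemma twelfthRoot_congr {m n : ℤ} (h : 12 ∣ m - n) : twelfthRoot m = twelfthRoot n := by
  rw [← sub_add_cancel m n, twelfthRoot_add, twelfthRoot_eq_one h, one_mul]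

lemma twelfthRoot_ne_zero (n : ℤ) : twelfthRoot n ≠ 0 := exp_ne_zero _

lemma twelve_dvd_of_three_dvd_of_four_dvd {n : ℤ} (h₃ : 3 ∣ n) (h₄ : 4 ∣ n) : 12 ∣ n := by
  omega

lemma etaSqExponent_T_mul {a b c d : ℤ} (h : a * d - b * c = 1) :
    12 ∣ etaSqExponent (a + c) (b + d) c d - (1 + etaSqExponent a b c d) := by
  apply twelve_dvd_of_three_dvd_of_four_dvd
  · replace h := congrArg (Int.cast : ℤ → ZMod 3) h
    refine (ZMod.intCast_zmod_eq_zero_iff_dvd _ 3).mp ?_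
    simp only [etaSqExponent]
    push_cast at h ⊢
    generalize (a : ZMod 3) = a, (b : ZMod 3) = b, (c : ZMod 3) = c, (d : ZMod 3) = d at *
    decide +revert
  · replace h := congrArg (Int.cast : ℤ → ZMod 4) h
    refine (ZMod.intCast_zmod_eq_zero_iff_dvd _ 4).mp ?_
    simp only [etaSqExponent]
    push_cast at h ⊢
    generalize (a : ZMod 4) = a, (b : ZMod 4) = b, (c : ZMod 4) = c, (d : ZMod 4) = d at *
    decide +revert

lemma etaSqExponent_S_mul {a b c d : ℤ} (h : a * d - b * c = 1) :
    12 ∣ etaSqExponent (-c) (-d) a b - (-3 + etaSqExponent a b c d) := by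
  apply twelve_dvd_of_three_dvd_of_four_dvd
  · replace h := congrArg (Int.cast : ℤ → ZMod 3) h
    refine (ZMod.intCast_zmod_eq_zero_iff_dvd _ 3).mp ?_
    simp only [etaSqExponent]
    push_cast at h ⊢
    generalize (a : ZMod 3) = a, (b : ZMod 3) = b, (c : ZMod 3) = c, (d : ZMod 3) = d at *
    decide +revert
  · replace h := congrArg (Int.cast : ℤ → ZMod 4) h
    refine (ZMod.intCast_zmod_eq_zero_iff_dvd _ 4).mp ?_
    simp only [etaSqExponent]
    push_cast at h ⊢
    generalize (a : ZMod 4) = a, (b : ZMod 4) = b, (c : ZMod 4) = c, (d : ZMod 4) = d at *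
    decide +revert

/-- As `23 ≡ -1` modulo `12`, conjugation by `diag(23, 1)` inverts the multiplier of `η²`. -/
lemma etaSqExponent_add_conj {a b c d : ℤ} (h : a * d - b * (23 * c) = 1) :
    12 ∣ etaSqExponent a b (23 * c) d + etaSqExponent a (23 * b) c d := by
  apply twelve_dvd_of_three_dvd_of_four_dvd
  · replace h := congrArg (Int.cast : ℤ → ZMod 3) h
    refine (ZMod.intCast_zmod_eq_zero_iff_dvd _ 3).mp ?_
    simp only [etaSqExponent]
    push_cast at h ⊢
    generalize (a : ZMod 3) = a, (b : ZMod 3) = b, (c : ZMod 3) = c, (d : ZMod 3) = d at *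
    decide +revert
  · replace h := congrArg (Int.cast : ℤ → ZMod 4) h
    refine (ZMod.intCast_zmod_eq_zero_iff_dvd _ 4).mp ?_
    simp only [etaSqExponent]
    push_cast at h ⊢
    generalize (a : ZMod 4) = a, (b : ZMod 4) = b, (c : ZMod 4) = c, (d : ZMod 4) = d at *
    decide +revert

/-- The multiplier of `η²` at a matrix of `SL₂(ℤ)`. -/
def etaSqMultiplier (γ : SL(2, ℤ)) : ℂ :=
  twelfthRoot (etaSqExponent (γ 0 0) (γ 0 1) (γ 1 0) (γ 1 1))

lemma SL2Z_det (γ : SL(2, ℤ)) : γ 0 0 * γ 1 1 - γ 0 1 * γ 1 0 = 1 := by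
  rw [← Matrix.det_fin_two, γ.det_coe]

lemma etaSqMultiplier_T_mul (γ : SL(2, ℤ)) :
    etaSqMultiplier (ModularGroup.T * γ) = twelfthRoot 1 * etaSqMultiplier γ := by
  rw [etaSqMultiplier, etaSqMultiplier, ← twelfthRoot_add]
  apply twelfthRoot_congr
  convert etaSqExponent_T_mul (SL2Z_det γ) using 3
  all_goals simp [ModularGroup.coe_T, Matrix.mul_apply, Fin.sum_univ_two]

lemma etaSqMultiplier_S_mul (γ : SL(2, ℤ)) :
    etaSqMultiplier (ModularGroup.S * γ) = twelfthRoot (-3) * etaSqMultiplier γ := by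
  rw [etaSqMultiplier, etaSqMultiplier, ← twelfthRoot_add]
  apply twelfthRoot_congr
  convert etaSqExponent_S_mul (SL2Z_det γ) using 3
  all_goals simp [ModularGroup.coe_S, Matrix.mul_apply, Fin.sum_univ_two]

/-- The square of `η` on the upper half-plane. -/
def etaSq (z : ℍ) : ℂ := η z ^ 2

lemma twelfthRoot_neg_three : twelfthRoot (-3) = I⁻¹ := by
  have : (2 * Real.pi * I * ((-3 : ℤ) / 12) : ℂ) = -(Real.pi / 2 * I) := by push_cast; ring
  rw [twelfthRoot, this, exp_neg, exp_pi_div_two_mul_I]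

lemma csqrt_sq (z : ℂ) : sqrt z ^ 2 = z := by
  simp [sqrt, ← cpow_nat_mul]

lemma etaSq_slash_S : etaSq ∣[(1 : ℤ)] ModularGroup.S = twelfthRoot (-3) • etaSq := by
  ext z
  have he : η (-(↑z)⁻¹) = (sqrt I)⁻¹ * (sqrt z * η z) := by
    simpa [neg_div] using eta_comp_eq_csqrt_I_inv z.2
  have hz := z.ne_zero
  rw [SL_slash_apply, UpperHalfPlane.modular_S_smul]
  suffices η (-(↑z)⁻¹) ^ 2 * (z : ℂ)⁻¹ = twelfthRoot (-3) * η z ^ 2 by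
    simpa [ModularGroup.denom_apply, ModularGroup.coe_S, etaSq]
  rw [he, twelfthRoot_neg_three, mul_pow, mul_pow, inv_pow, csqrt_sq, csqrt_sq]
  field_simp

lemma eta_add_one (z : ℂ) : η (z + 1) = exp (2 * Real.pi * I / 24) * η z := by
  have h (n : ℕ) : eta_q n (z + 1) = eta_q n z := by
    rw [eta_q_eq_pow, eta_q_eq_pow, mul_add, mul_one, exp_add, exp_two_pi_mul_I, mul_one]
  simp only [ModularForm.eta, h, ← mul_assoc, Function.Periodic.qParam, ← exp_add]
  congr 2
  push_cast
  ring

lemma etaSq_slash_T : etaSq ∣[(1 : ℤ)] ModularGroup.T = twelfthRoot 1 • etaSq := by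
  ext z
  rw [SL_slash_apply, UpperHalfPlane.modular_T_smul]
  suffices η (z + 1) ^ 2 = twelfthRoot 1 * η z ^ 2 by
    simpa [ModularGroup.denom_apply, ModularGroup.coe_T, etaSq, add_comm]
  rw [eta_add_one, mul_pow, ← exp_nat_mul, twelfthRoot]
  congr 2
  push_cast
  ring

lemma etaSq_slash (γ : SL(2, ℤ)) : etaSq ∣[(1 : ℤ)] γ = etaSqMultiplier γ • etaSq := by
  have hγ : γ ∈ Subgroup.closure {ModularGroup.S, ModularGroup.T} := by
    rw [SpecialLinearGroup.SL2Z_generators]; trivial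
  have key : ∀ x ∈ ({ModularGroup.S, ModularGroup.T} : Set SL(2, ℤ)), ∃ r : ℂ, r ≠ 0 ∧
      etaSq ∣[(1 : ℤ)] x = r • etaSq ∧ ∀ y, etaSqMultiplier (x * y) = r * etaSqMultiplier y := by
    rintro x (rfl | rfl)
    · exact ⟨_, twelfthRoot_ne_zero _, etaSq_slash_S, etaSqMultiplier_S_mul⟩
    · exact ⟨_, twelfthRoot_ne_zero _, etaSq_slash_T, etaSqMultiplier_T_mul⟩
  induction hγ using Subgroup.closure_induction_left with
  | one =>
    rw [SlashAction.slash_one]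
    simp [etaSqMultiplier, etaSqExponent, twelfthRoot_eq_one]
  | mul_left x hx y _ ih =>
    obtain ⟨r, -, hr, hmul⟩ := key x hx
    rw [SlashAction.slash_mul, hr, SL_smul_slash, ih, hmul, mul_smul]
  | inv_mul_cancel x hx y _ ih =>
    obtain ⟨r, hr₀, hr, hmul⟩ := key x hx
    apply smul_right_injective _ hr₀
    dsimp only
    rw [← mul_smul, ← hmul, mul_inv_cancel_left, ← ih, ← SL_smul_slash, ← hr,
      ← SlashAction.slash_mul, mul_inv_cancel_left]

lemma coe_SL2Z_smul (γ : SL(2, ℤ)) (z : ℍ) :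
    ((γ • z : ℍ) : ℂ) = ((γ 0 0 : ℂ) * z + γ 0 1) / ((γ 1 0 : ℂ) * z + γ 1 1) := by
  exact_mod_cast coe_specialLinearGroup_apply γ z

lemma SL2Z_denom_ne_zero (γ : SL(2, ℤ)) (z : ℍ) : (γ 1 0 : ℂ) * z + γ 1 1 ≠ 0 :=
  denom_ne_zero γ z

lemma eta_sq_smul (γ : SL(2, ℤ)) (z : ℍ) :
    η (γ • z : ℍ) ^ 2 = etaSqMultiplier γ * ((γ 1 0 : ℂ) * z + γ 1 1) * η z ^ 2 := by
  have h := congrFun (etaSq_slash γ) z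
  rw [SL_slash_apply, zpow_neg_one, ← div_eq_mul_inv, div_eq_iff (denom_ne_zero _ _)] at h
  simp only [Pi.smul_apply, smul_eq_mul, etaSq] at h
  rw [h]
  simp only [ModularGroup.denom_apply]
  ring

lemma dedekindEta_eq (z : ℂ) : dedekindEta z = η z := by
  simp only [dedekindEta, ModularForm.eta, qq, eta_q_eq_pow]
  simp [Function.Periodic.qParam]

lemma f23b_eq (z : ℂ) : f23b z = η z ^ 2 * η (23 * z) ^ 2 := by
  rw [f23b, dedekindEta_eq, dedekindEta_eq]

/-- Multiplication by `23` on the upper half-plane. -/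
def mulTwentyThree (z : ℍ) : ℍ := ⟨23 * z, by simpa using z.im_pos⟩

lemma f23b_differentiableAt {τ : ℂ} (hτ : 0 < τ.im) : DifferentiableAt ℂ f23b τ := by
  have h : 0 < (23 * τ).im := by simpa using hτ
  rw [funext f23b_eq]
  exact ((differentiableAt_eta_of_mem_upperHalfPlaneSet hτ).pow 2).mul
    (((differentiableAt_eta_of_mem_upperHalfPlaneSet h).comp τ (by fun_prop)).pow 2)

lemma f23b_smul {γ : SL(2, ℤ)} (hγ : γ ∈ CongruenceSubgroup.Gamma0 23) (z : ℍ) :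
    f23b (γ • z : ℍ) = ((γ 1 0 : ℂ) * z + γ 1 1) ^ 2 * f23b z := by
  obtain ⟨c, hc⟩ := (ZMod.intCast_zmod_eq_zero_iff_dvd _ 23).mp
    (CongruenceSubgroup.Gamma0_mem.mp hγ)
  push_cast at hc
  have hdet := SL2Z_det γ
  rw [hc] at hdet
  let δ : SL(2, ℤ) := ⟨!![γ 0 0, 23 * γ 0 1; c, γ 1 1], by
    rw [Matrix.det_fin_two_of]; linarith⟩
  have hδ : 23 * ((γ • z : ℍ) : ℂ) = (δ • mulTwentyThree z : ℍ) := by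
    rw [coe_SL2Z_smul, coe_SL2Z_smul, hc]
    simp only [δ, mulTwentyThree, Matrix.of_apply,
      Matrix.cons_val', Matrix.cons_val_zero, Matrix.cons_val_one, Matrix.cons_val_fin_one]
    push_cast
    rw [← mul_div_assoc]
    ring_nf
  have hχ : etaSqMultiplier γ * etaSqMultiplier δ = 1 := by
    rw [etaSqMultiplier, etaSqMultiplier, ← twelfthRoot_add, hc]
    exact twelfthRoot_eq_one (etaSqExponent_add_conj hdet)
  have hj : ((δ 1 0 : ℂ) * mulTwentyThree z + δ 1 1) = (γ 1 0 : ℂ) * z + γ 1 1 := by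
    rw [hc]
    simp [δ, mulTwentyThree]
    ring
  rw [f23b_eq, f23b_eq, hδ, eta_sq_smul, eta_sq_smul, hj]
  simp only [mulTwentyThree]
  linear_combination ((γ 1 0 : ℂ) * z + γ 1 1) ^ 2 * η z ^ 2 * η (23 * z) ^ 2 * hχ

lemma exists_norm_slash_f23b_pow_le (γ : SL(2, ℤ)) : ∃ C : ℝ, ∀ z : ℍ,
    ‖(((γ 1 0 : ℂ) * z + γ 1 1) ^ 2)⁻¹ * f23b (γ • z : ℍ)‖ ^ 12 ≤
      C / z.im ^ 6 * ‖discriminant z‖ := by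
  obtain ⟨C, hC⟩ := CuspFormClass.exists_bound CuspForm.discriminant
  refine ⟨C / 23 ^ 6, fun z ↦ ?_⟩
  set j : ℂ := (γ 1 0 : ℂ) * z + γ 1 1 with hj
  have hj₀ : j ≠ 0 := SL2Z_denom_ne_zero γ z
  have hjn : 0 < ‖j‖ := norm_pos_iff.mpr hj₀
  have hΔ : ‖discriminant (γ • z)‖ = ‖j‖ ^ 12 * ‖discriminant z‖ := by
    have h := (slash_action_eq'_iff 12 discriminant γ z).mp (congrFun
      (SlashInvariantForm.slash_action_generators_SL2Z discriminant_S_invariant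
        discriminant_T_invariant γ) z)
    rw [h, ← hj, norm_mul, norm_zpow]
    norm_cast
  have him : (mulTwentyThree (γ • z)).im = 23 * z.im / ‖j‖ ^ 2 := by
    have h : (γ • z).im = z.im / ‖j‖ ^ 2 := by
      rw [ModularGroup.im_smul_eq_div_normSq, ModularGroup.denom_apply, normSq_eq_norm_sq]
    have h' : (mulTwentyThree (γ • z)).im = 23 * (γ • z).im := by
      simp [mulTwentyThree, ← UpperHalfPlane.coe_im]
    rw [h', h, mul_div_assoc]
  have hb := hC (mulTwentyThree (γ • z))
  have hexp : ((12 : ℤ) / 2 : ℝ) = (6 : ℕ) := by norm_num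
  rw [CuspForm.coe_discriminant, hexp, Real.rpow_natCast, him] at hb
  have hf : ‖f23b (γ • z : ℍ)‖ ^ 12 =
      ‖discriminant (γ • z)‖ * ‖discriminant (mulTwentyThree (γ • z))‖ := by
    rw [f23b_eq, discriminant, discriminant, ← norm_pow, ← norm_mul]
    simp only [mulTwentyThree]
    ring_nf
  rw [norm_mul, norm_inv, norm_pow, mul_pow, hf, hΔ]
  have hz := z.im_pos
  generalize ‖discriminant (mulTwentyThree (γ • z))‖ = x at hb ⊢
  have hy : 0 ≤ ‖discriminant z‖ := norm_nonneg _
  generalize ‖discriminant z‖ = y at hy ⊢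
  generalize ‖j‖ = r at hjn hb ⊢
  generalize z.im = t at hz hb ⊢
  calc ((r ^ 2)⁻¹) ^ 12 * (r ^ 12 * y * x)
      ≤ ((r ^ 2)⁻¹) ^ 12 * (r ^ 12 * y * (C / (23 * t / r ^ 2) ^ 6)) := by gcongr
    _ = C / 23 ^ 6 / t ^ 6 * y := by field_simp

lemma tendsto_slash_f23b (γ : SL(2, ℤ)) :
    Filter.Tendsto (fun z : ℍ ↦ (((γ 1 0 : ℂ) * z + γ 1 1) ^ 2)⁻¹ * f23b (γ • z : ℍ))
      atImInfty (nhds 0) := by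
  obtain ⟨C, hC⟩ := exists_norm_slash_f23b_pow_le γ
  have him : Filter.Tendsto (fun z : ℍ ↦ z.im ^ 6) atImInfty Filter.atTop :=
    (Filter.tendsto_pow_atTop (by norm_num)).comp Filter.tendsto_comap
  have hΔ : Filter.Tendsto (fun z ↦ ‖discriminant z‖) atImInfty (nhds 0) := by
    simpa using discriminant_isZeroAtImInfty.norm
  have h := squeeze_zero (fun z ↦ by positivity) hC
    (by simpa using (him.const_div_atTop C).mul hΔ)
  have h' := h.rpow_const (p := ((12 : ℕ) : ℝ)⁻¹) (Or.inr (by positivity))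
  rw [Real.zero_rpow (by norm_num)] at h'
  refine tendsto_zero_iff_norm_tendsto_zero.mpr (h'.congr fun z ↦ ?_)
  exact Real.pow_rpow_inv_natCast (norm_nonneg _) (by norm_num)

/-- `f_{23,b}` is a cusp form of weight `2` for `Γ₀(23)`: it is holomorphic
on the upper half-plane, transforms with weight `2` under `Γ₀(23)`, and tends to `0` as
`ℑτ → ∞` after slashing by any `γ ∈ SL₂(ℤ)`. -/
theorem stmt_8 :
    (∀ τ : ℂ, 0 < τ.im → DifferentiableAt ℂ f23b τ) ∧
    (∀ γ ∈ CongruenceSubgroup.Gamma0 23, ∀ τ : ℂ, 0 < τ.im →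
      f23b (((γ.1 0 0 : ℂ) * τ + (γ.1 0 1 : ℂ)) / ((γ.1 1 0 : ℂ) * τ + (γ.1 1 1 : ℂ)))
        = ((γ.1 1 0 : ℂ) * τ + (γ.1 1 1 : ℂ)) ^ 2 * f23b τ) ∧
    (∀ γ : Matrix.SpecialLinearGroup (Fin 2) ℤ,
      Filter.Tendsto (fun τ : ℂ => (((γ.1 1 0 : ℂ) * τ + (γ.1 1 1 : ℂ)) ^ 2)⁻¹ *
          f23b (((γ.1 0 0 : ℂ) * τ + (γ.1 0 1 : ℂ)) / ((γ.1 1 0 : ℂ) * τ + (γ.1 1 1 : ℂ))))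
        (Filter.comap Complex.im Filter.atTop) (nhds 0)) := by
  refine ⟨fun τ hτ ↦ f23b_differentiableAt hτ, fun γ hγ τ hτ ↦ ?_, fun γ ↦ ?_⟩
  · rw [← f23b_smul hγ ⟨τ, hτ⟩, coe_SL2Z_smul]
  · refine ((tendsto_slash_f23b γ).comp tendsto_comap_im_ofComplex).congr' ?_
    filter_upwards [Filter.preimage_mem_comap (Filter.Ioi_mem_atTop 0)] with τ hτ
    simp only [Function.comp_apply, coe_SL2Z_smul, ofComplex_apply_of_im_pos hτ]
end
end
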